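/- Every cubic pregraph that has a C4-quotient 2-factor has at most two pairwise non-isomorphic C4-quotient 2-factors. -/

import Mathlib

/-- The possible "ends" of an edge in a pregraph: an ordinary edge (or loop)
with two endpoints, or a semi-edge with a single endpoint. -/
inductive PEnds (V : Type) where
  | edge : V → V → PEnds V
  | semi : V → PEnds V
  deriving DecidableEq

/-- A finite pregraph: a multigraph that may contain loops, parallel edges and
semi-edges.  Edges are abstract and carry their endpoints via `ends`. -/
structure Pregraph where
  V : Type
  E : Type
  [fintypeV : Fintype V]
  [decEqV : DecidableEq V]
  [fintypeE : Fintype E]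
  [decEqE : DecidableEq E]
  ends : E → PEnds V

attribute [instance] Pregraph.fintypeV Pregraph.decEqV Pregraph.fintypeE Pregraph.decEqE

namespace Pregraph

/-- The number of end-points that edge `e` has at the vertex `v`
(a loop at `v` counts twice, a semi-edge once). -/
def endCount (P : Pregraph) (v : P.V) (e : P.E) : ℕ :=
  match P.ends e with
  | .edge a b => (if a = v then 1 else 0) + (if b = v then 1 else 0)
  | .semi a => if a = v then 1 else 0

/-- The degree of a vertex: loops count 2, semi-edges count 1. -/
def degree (P : Pregraph) (v : P.V) : ℕ := ∑ e : P.E, P.endCount v e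

open Classical in
/-- The degree of a vertex inside a set `F` of edges. -/
noncomputable def degIn (P : Pregraph) (F : Set P.E) (v : P.V) : ℕ :=
  ∑ e : P.E, if e ∈ F then P.endCount v e else 0

/-- `e` is a proper edge with endpoints `a` and `b`. -/
def joins (P : Pregraph) (e : P.E) (a b : P.V) : Prop :=
  P.ends e = .edge a b ∨ P.ends e = .edge b a

/-- The edge `e` is incident to the vertex `v`. -/
def incident (P : Pregraph) (e : P.E) (v : P.V) : Prop :=
  match P.ends e with
  | .edge a b => a = v ∨ b = v
  | .semi a => a = v

/-- Adjacency via a proper edge. -/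
def Adj (P : Pregraph) (u w : P.V) : Prop := ∃ e, P.joins e u w

/-- Connectedness of a pregraph. -/
def Connected (P : Pregraph) : Prop := ∀ u w : P.V, Relation.ReflTransGen P.Adj u w

/-- A cubic pregraph: connected and every vertex has degree 3. -/
def Cubic (P : Pregraph) : Prop := P.Connected ∧ ∀ v, P.degree v = 3

/-- The edge `e` has at least one endpoint in the vertex set `C`. -/
def touches (P : Pregraph) (e : P.E) (C : Set P.V) : Prop :=
  match P.ends e with
  | .edge a b => a ∈ C ∨ b ∈ C
  | .semi a => a ∈ C

/-- `C` is a component of the edge set `F` of type `q₁` : a 4-cycle. -/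
def IsQ1Comp (P : Pregraph) (F : Set P.E) (C : Set P.V) : Prop :=
  ∃ a b c d : P.V, a ≠ b ∧ a ≠ c ∧ a ≠ d ∧ b ≠ c ∧ b ≠ d ∧ c ≠ d ∧
    C = {a, b, c, d} ∧
    ∃ e1 e2 e3 e4 : P.E, e1 ≠ e2 ∧ e1 ≠ e3 ∧ e1 ≠ e4 ∧ e2 ≠ e3 ∧ e2 ≠ e4 ∧ e3 ≠ e4 ∧
      {e ∈ F | P.touches e C} = {e1, e2, e3, e4} ∧
      P.joins e1 a b ∧ P.joins e2 b c ∧ P.joins e3 c d ∧ P.joins e4 d a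

/-- `C` is a component of the edge set `F` of type `q₂` : a digon. -/
def IsQ2Comp (P : Pregraph) (F : Set P.E) (C : Set P.V) : Prop :=
  ∃ a b : P.V, a ≠ b ∧ C = {a, b} ∧
    ∃ e1 e2 : P.E, e1 ≠ e2 ∧ {e ∈ F | P.touches e C} = {e1, e2} ∧
      P.joins e1 a b ∧ P.joins e2 a b

/-- `C` is a component of the edge set `F` of type `q₃` : an edge together with
a semi-edge at each endpoint. -/
def IsQ3Comp (P : Pregraph) (F : Set P.E) (C : Set P.V) : Prop :=
  ∃ a b : P.V, a ≠ b ∧ C = {a, b} ∧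
    ∃ e1 e2 e3 : P.E, e1 ≠ e2 ∧ e1 ≠ e3 ∧ e2 ≠ e3 ∧
      {e ∈ F | P.touches e C} = {e1, e2, e3} ∧
      P.joins e1 a b ∧ P.ends e2 = .semi a ∧ P.ends e3 = .semi b

/-- `C` is a component of the edge set `F` of type `q₄` : a single vertex with
two semi-edges. -/
def IsQ4Comp (P : Pregraph) (F : Set P.E) (C : Set P.V) : Prop :=
  ∃ a : P.V, C = {a} ∧
    ∃ e1 e2 : P.E, e1 ≠ e2 ∧ {e ∈ F | P.touches e C} = {e1, e2} ∧
      P.ends e1 = .semi a ∧ P.ends e2 = .semi a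

/-- `C` is a component of `F` which is a quotient of `C₄`. -/
def IsCQComp (P : Pregraph) (F : Set P.E) (C : Set P.V) : Prop :=
  P.IsQ1Comp F C ∨ P.IsQ2Comp F C ∨ P.IsQ3Comp F C ∨ P.IsQ4Comp F C

/-- `F` is a `C₄`-quotient 2-factor with component partition `Ps`. -/
def IsCQFactorWith (P : Pregraph) (F : Set P.E) (Ps : Set (Set P.V)) : Prop :=
  (∀ C ∈ Ps, P.IsCQComp F C) ∧
  (∀ v : P.V, ∃ C ∈ Ps, v ∈ C) ∧
  (∀ C ∈ Ps, ∀ D ∈ Ps, C ≠ D → Disjoint C D)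

/-- `F` is a `C₄`-quotient 2-factor: a spanning subgraph in which every vertex has
degree 2 and every component is a quotient of `C₄`. -/
def IsCQFactor (P : Pregraph) (F : Set P.E) : Prop := ∃ Ps, P.IsCQFactorWith F Ps

/-- The pregraph has a `C₄`-quotient 2-factor. -/
def HasCQFactor (P : Pregraph) : Prop := ∃ F, P.IsCQFactor F

/-- Compatibility of ends under a vertex map (edges are unordered). -/
def endsRel {V W : Type} (σ : V → W) : PEnds V → PEnds W → Prop
  | .edge a b, x => x = .edge (σ a) (σ b) ∨ x = .edge (σ b) (σ a)
  | .semi a, x => x = .semi (σ a)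

/-- An isomorphism of pregraphs. -/
structure Iso (P Q : Pregraph) where
  vmap : P.V ≃ Q.V
  emap : P.E ≃ Q.E
  compat : ∀ e, endsRel vmap (P.ends e) (Q.ends (emap e))

/-- Two edge sets (e.g. two 2-factors) of `P` are isomorphic if some automorphism
of `P` maps one onto the other. -/
def FactorIso (P : Pregraph) (F1 F2 : Set P.E) : Prop :=
  ∃ φ : Iso P P, ∀ e, e ∈ F1 ↔ φ.emap e ∈ F2

/-- Adjacency in the ladder graph `K₂ × Pₙ` on `Fin n × Fin 2`. -/
def ladderAdj (n : ℕ) (p q : Fin n × Fin 2) : Prop :=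
  (p.1 = q.1 ∧ p.2 ≠ q.2) ∨ (p.2 = q.2 ∧ ((p.1 : ℕ) + 1 = q.1 ∨ (q.1 : ℕ) + 1 = p.1))

/-- The subgraph of `P` with vertex set `S` and edge set `F` is isomorphic to the
ladder `K₂ × Pₙ` for some `n ≥ 2`. -/
def IsLadder (P : Pregraph) (S : Set P.V) (F : Set P.E) : Prop :=
  ∃ n : ℕ, 2 ≤ n ∧ ∃ f : Fin n × Fin 2 → P.V, Function.Injective f ∧
    S = Set.range f ∧
    (∀ e ∈ F, ∃ p q, ladderAdj n p q ∧ P.joins e (f p) (f q)) ∧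
    (∀ p q, ladderAdj n p q → ∃! e, e ∈ F ∧ P.joins e (f p) (f q))

/-- A ladder of `P`: a maximal subgraph isomorphic to `K₂ × Pₙ`, `n ≥ 2`. -/
def IsMaxLadder (P : Pregraph) (S : Set P.V) (F : Set P.E) : Prop :=
  P.IsLadder S F ∧
  ∀ S' F', P.IsLadder S' F' → S ⊆ S' → F ⊆ F' → S = S' ∧ F = F'

/-- A digon: two distinct vertices joined by two parallel edges. -/
def IsDigonPair (P : Pregraph) (a b : P.V) : Prop :=
  a ≠ b ∧ ∃ e1 e2 : P.E, e1 ≠ e2 ∧ P.joins e1 a b ∧ P.joins e2 a b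

end Pregraph

namespace Pregraph

/-- The other end of `e`, seen from `v`. -/
def tgt (P : Pregraph) (e : P.E) (v : P.V) : P.V :=
  match P.ends e with
  | .edge a b => if a = v then b else a
  | .semi _ => v

variable {P : Pregraph}

lemma inc_joins {e : P.E} {a b : P.V} (h : P.joins e a b) (v : P.V) :
    P.incident e v ↔ v = a ∨ v = b := by
  unfold incident; rcases h with h | h <;> rw [h] <;> simp <;> grind

lemma inc_semi {e : P.E} {a : P.V} (h : P.ends e = .semi a) (v : P.V) :
    P.incident e v ↔ v = a := by
  unfold incident; rw [h]; simp; grind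

lemma tgt_joins {e : P.E} {a b : P.V} (h : P.joins e a b) : P.tgt e a = b := by
  unfold tgt; rcases h with h | h <;> rw [h] <;> simp <;> grind

lemma tgt_semi {e : P.E} {a : P.V} (h : P.ends e = .semi a) (v : P.V) : P.tgt e v = v := by
  unfold tgt; rw [h]

lemma joins_symm {e : P.E} {a b : P.V} (h : P.joins e a b) : P.joins e b a := Or.symm h

lemma ec_joins {e : P.E} {a b : P.V} (hab : a ≠ b) (h : P.joins e a b) : P.endCount a e = 1 := by
  unfold endCount; rcases h with h | h <;> rw [h] <;> simp <;> grind

lemma ec_semi {e : P.E} {a : P.V} (h : P.ends e = .semi a) : P.endCount a e = 1 := by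
  unfold endCount; rw [h]; simp

lemma ec_pos (e : P.E) (v : P.V) : P.endCount v e ≠ 0 ↔ P.incident e v := by
  unfold endCount incident; split <;> simp <;> grind

lemma touches_of_inc {e : P.E} {v : P.V} {C : Set P.V} (h : P.incident e v) (hv : v ∈ C) :
    P.touches e C := by
  unfold incident at h; unfold touches; revert h; split <;> grind

/-- Either `e` is a proper edge from `v` to its target, or a semi-edge at `v`. -/
lemma inc_cases {e : P.E} {v : P.V} (h : P.incident e v) :
    P.joins e v (P.tgt e v) ∨ (P.ends e = .semi v ∧ P.tgt e v = v) := by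
  unfold incident at h; unfold joins tgt; revert h
  split <;> rename_i h' <;> rw [h'] <;> simp <;> grind

lemma inc_tgt {e : P.E} {v : P.V} (h : P.incident e v) : P.incident e (P.tgt e v) := by
  rcases inc_cases h with h' | ⟨h', h2⟩
  · exact (inc_joins h' _).2 (Or.inr rfl)
  · rwa [h2]

lemma tgt_tgt {e : P.E} {v : P.V} (h : P.incident e v) : P.tgt e (P.tgt e v) = v := by
  rcases inc_cases h with h' | ⟨h', h2⟩
  · exact tgt_joins (joins_symm h')
  · rw [h2, h2]

lemma eq_of_inc {e : P.E} {v w : P.V} (h : P.incident e v) (hw : P.incident e w) :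
    w = v ∨ w = P.tgt e v := by
  rcases inc_cases h with h' | ⟨h', h2⟩
  · exact (inc_joins h' _).1 hw
  · exact Or.inl ((inc_semi h' _).1 hw)

/-- Local structure of a factor at a vertex. -/
def LocAt (P : Pregraph) (F : Set P.E) (v : P.V) : Prop :=
  ∃ p q : P.E, p ≠ q ∧ p ∈ F ∧ q ∈ F ∧ P.endCount v p = 1 ∧ P.endCount v q = 1 ∧
    (∀ e ∈ F, P.incident e v → e = p ∨ e = q) ∧
    ∃ y, (∀ f ∈ F, P.incident f (P.tgt p v) → f ≠ p → P.tgt f (P.tgt p v) = y) ∧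
      (∀ f ∈ F, P.incident f (P.tgt q v) → f ≠ q → P.tgt f (P.tgt q v) = y)

lemma locAt_q1 {F : Set P.E} {C : Set P.V} {a b c d : P.V} (hab : a ≠ b) (hac : a ≠ c)
    (had : a ≠ d) (hbc : b ≠ c) (hbd : b ≠ d) (hcd : c ≠ d)
    (ha : a ∈ C) (hb : b ∈ C) (hd : d ∈ C) {e1 e2 e3 e4 : P.E}
    (h14 : e1 ≠ e4)
    (hF : ∀ e, (e ∈ F ∧ P.touches e C) ↔ e = e1 ∨ e = e2 ∨ e = e3 ∨ e = e4)
    (j1 : P.joins e1 a b) (j2 : P.joins e2 b c) (j3 : P.joins e3 c d) (j4 : P.joins e4 d a) :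
    P.LocAt F a := by
  have i1 := inc_joins j1
  have i2 := inc_joins j2
  have i3 := inc_joins j3
  have i4 := inc_joins j4
  have j4' := joins_symm j4
  refine ⟨e1, e4, h14, ((hF e1).2 (by simp)).1, ((hF e4).2 (by simp)).1, ec_joins hab j1,
    ec_joins had j4', ?_, c, ?_, ?_⟩
  · intro e he hi
    have := (hF e).1 ⟨he, touches_of_inc hi ha⟩
    grind
  · rw [tgt_joins j1]
    intro f hf hi hne
    have := (hF f).1 ⟨hf, touches_of_inc hi hb⟩
    have := tgt_joins j2
    grind
  · rw [tgt_joins j4']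
    intro f hf hi hne
    have := (hF f).1 ⟨hf, touches_of_inc hi hd⟩
    have := tgt_joins (joins_symm j3)
    grind

lemma locAt_q2 {F : Set P.E} {C : Set P.V} {a b : P.V} (hab : a ≠ b)
    (ha : a ∈ C) (hb : b ∈ C) {e1 e2 : P.E} (h12 : e1 ≠ e2)
    (hF : ∀ e, (e ∈ F ∧ P.touches e C) ↔ e = e1 ∨ e = e2)
    (j1 : P.joins e1 a b) (j2 : P.joins e2 a b) : P.LocAt F a := by
  refine ⟨e1, e2, h12, ((hF e1).2 (by simp)).1, ((hF e2).2 (by simp)).1, ec_joins hab j1,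
    ec_joins hab j2, ?_, a, ?_, ?_⟩
  · intro e he hi
    exact (hF e).1 ⟨he, touches_of_inc hi ha⟩
  · rw [tgt_joins j1]
    intro f hf hi hne
    have := (hF f).1 ⟨hf, touches_of_inc hi hb⟩
    have := tgt_joins (joins_symm j2)
    grind
  · rw [tgt_joins j2]
    intro f hf hi hne
    have := (hF f).1 ⟨hf, touches_of_inc hi hb⟩
    have := tgt_joins (joins_symm j1)
    grind

lemma locAt_q3 {F : Set P.E} {C : Set P.V} {a b : P.V} (hab : a ≠ b)
    (ha : a ∈ C) (hb : b ∈ C) {e1 e2 e3 : P.E} (h12 : e1 ≠ e2)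
    (hF : ∀ e, (e ∈ F ∧ P.touches e C) ↔ e = e1 ∨ e = e2 ∨ e = e3)
    (j1 : P.joins e1 a b) (j2 : P.ends e2 = .semi a) (j3 : P.ends e3 = .semi b) :
    P.LocAt F a := by
  have i1 := inc_joins j1
  have i2 := inc_semi j2
  have i3 := inc_semi j3
  refine ⟨e1, e2, h12, ((hF e1).2 (by simp)).1, ((hF e2).2 (by simp)).1, ec_joins hab j1,
    ec_semi j2, ?_, b, ?_, ?_⟩
  · intro e he hi
    have := (hF e).1 ⟨he, touches_of_inc hi ha⟩
    grind
  · rw [tgt_joins j1]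
    intro f hf hi hne
    have := (hF f).1 ⟨hf, touches_of_inc hi hb⟩
    have := tgt_semi j3 b
    grind
  · rw [tgt_semi j2]
    intro f hf hi hne
    have := (hF f).1 ⟨hf, touches_of_inc hi ha⟩
    have := tgt_joins j1
    grind

lemma locAt_q4 {F : Set P.E} {C : Set P.V} {a : P.V}
    (ha : a ∈ C) {e1 e2 : P.E} (h12 : e1 ≠ e2)
    (hF : ∀ e, (e ∈ F ∧ P.touches e C) ↔ e = e1 ∨ e = e2)
    (j1 : P.ends e1 = .semi a) (j2 : P.ends e2 = .semi a) : P.LocAt F a := by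
  refine ⟨e1, e2, h12, ((hF e1).2 (by simp)).1, ((hF e2).2 (by simp)).1, ec_semi j1,
    ec_semi j2, ?_, a, ?_, ?_⟩
  · intro e he hi
    exact (hF e).1 ⟨he, touches_of_inc hi ha⟩
  · rw [tgt_semi j1]
    intro f hf hi hne
    have := (hF f).1 ⟨hf, touches_of_inc hi ha⟩
    have := tgt_semi j2 a
    grind
  · rw [tgt_semi j2]
    intro f hf hi hne
    have := (hF f).1 ⟨hf, touches_of_inc hi ha⟩
    have := tgt_semi j1 a
    grind

lemma locAt_of_factor {F : Set P.E} (h : P.IsCQFactor F) (v : P.V) : P.LocAt F v := by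
  obtain ⟨Ps, h1, h2, -⟩ := h
  obtain ⟨C, hC, hv⟩ := h2 v
  rcases h1 C hC with h | h | h | h
  · obtain ⟨a, b, c, d, hab, hac, had, hbc, hbd, hcd, hCC, e1, e2, e3, e4, h12, h13, h14, h23,
      h24, h34, hS, j1, j2, j3, j4⟩ := h
    have hF : ∀ e, (e ∈ F ∧ P.touches e C) ↔ e = e1 ∨ e = e2 ∨ e = e3 ∨ e = e4 := by
      intro e; have := Set.ext_iff.1 hS e; simpa using this
    have ma : a ∈ C := by simp [hCC]
    have mb : b ∈ C := by simp [hCC]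
    have mc : c ∈ C := by simp [hCC]
    have md : d ∈ C := by simp [hCC]
    have hv' : v = a ∨ v = b ∨ v = c ∨ v = d := by simpa [hCC] using hv
    rcases hv' with rfl | rfl | rfl | rfl
    · exact locAt_q1 hab hac had hbc hbd hcd ma mb md h14 hF j1 j2 j3 j4
    · exact locAt_q1 hbc hbd hab.symm hcd hac.symm had.symm mb mc ma h12.symm
        (fun e => (hF e).trans (by tauto)) j2 j3 j4 j1
    · exact locAt_q1 hcd hac.symm hbc.symm had.symm hbd.symm hab mc md mb h23.symm
        (fun e => (hF e).trans (by tauto)) j3 j4 j1 j2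
    · exact locAt_q1 had.symm hbd.symm hcd.symm hab hac hbc md ma mc h34.symm
        (fun e => (hF e).trans (by tauto)) j4 j1 j2 j3
  · obtain ⟨a, b, hab, hCC, e1, e2, h12, hS, j1, j2⟩ := h
    have hF : ∀ e, (e ∈ F ∧ P.touches e C) ↔ e = e1 ∨ e = e2 := by
      intro e; have := Set.ext_iff.1 hS e; simpa using this
    have ma : a ∈ C := by simp [hCC]
    have mb : b ∈ C := by simp [hCC]
    have hv' : v = a ∨ v = b := by simpa [hCC] using hv
    rcases hv' with rfl | rfl
    · exact locAt_q2 hab ma mb h12 hF j1 j2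
    · exact locAt_q2 hab.symm mb ma h12 hF (joins_symm j1) (joins_symm j2)
  · obtain ⟨a, b, hab, hCC, e1, e2, e3, h12, h13, h23, hS, j1, j2, j3⟩ := h
    have hF : ∀ e, (e ∈ F ∧ P.touches e C) ↔ e = e1 ∨ e = e2 ∨ e = e3 := by
      intro e; have := Set.ext_iff.1 hS e; simpa using this
    have ma : a ∈ C := by simp [hCC]
    have mb : b ∈ C := by simp [hCC]
    have hv' : v = a ∨ v = b := by simpa [hCC] using hv
    rcases hv' with rfl | rfl
    · exact locAt_q3 hab ma mb h12 hF j1 j2 j3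
    · exact locAt_q3 hab.symm mb ma h13 (fun e => (hF e).trans (by tauto)) (joins_symm j1) j3 j2
  · obtain ⟨a, hCC, e1, e2, h12, hS, j1, j2⟩ := h
    have hF : ∀ e, (e ∈ F ∧ P.touches e C) ↔ e = e1 ∨ e = e2 := by
      intro e; have := Set.ext_iff.1 hS e; simpa using this
    have ma : a ∈ C := by simp [hCC]
    have hv' : v = a := by simpa [hCC] using hv
    subst hv'
    exact locAt_q4 ma h12 hF j1 j2

lemma third_edge {v : P.V} (hd : P.degree v = 3) {p q : P.E} (hpq : p ≠ q)
    (hp : P.endCount v p = 1) (hq : P.endCount v q = 1) :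
    ∃ m, m ≠ p ∧ m ≠ q ∧ P.endCount v m = 1 ∧ ∀ e, P.incident e v → e = p ∨ e = q ∨ e = m := by
  unfold degree at hd
  rw [← Finset.add_sum_erase _ _ (Finset.mem_univ p),
    ← Finset.add_sum_erase _ _ (Finset.mem_erase.2 ⟨hpq.symm, Finset.mem_univ q⟩), hp, hq] at hd
  have hs : ∑ e ∈ (Finset.univ.erase p).erase q, P.endCount v e = 1 := by omega
  obtain ⟨m, hm, hm0⟩ : ∃ m ∈ (Finset.univ.erase p).erase q, P.endCount v m ≠ 0 := by
    by_contra! h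
    rw [Finset.sum_eq_zero h] at hs
    omega
  rw [← Finset.add_sum_erase _ _ hm] at hs
  have hz : ∑ e ∈ ((Finset.univ.erase p).erase q).erase m, P.endCount v e = 0 := by omega
  rw [Finset.sum_eq_zero_iff] at hz
  simp only [Finset.mem_erase, Finset.mem_univ, and_true] at hm hz
  refine ⟨m, hm.2, hm.1, by omega, fun e he => ?_⟩
  by_contra! h
  exact (ec_pos e v).2 he (hz e ⟨h.2.2, h.2.1, h.1⟩)

/-- The structure at all vertices extracted from a factor, with complementary matching `M`. -/
structure Fac (P : Pregraph) (F : Set P.E) (M : P.V → P.E) : Prop where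
  inc : ∀ v, P.incident (M v) v
  notin : ∀ v, M v ∉ F
  mem : ∀ v e, P.incident e v → e ≠ M v → e ∈ F
  other : ∀ v e, ∃ f, P.incident f v ∧ f ≠ M v ∧ f ≠ e
  three : ∀ v a b c d, P.incident a v → P.incident b v → P.incident c v → P.incident d v →
    a ≠ b → a ≠ c → b ≠ c → d = a ∨ d = b ∨ d = c
  sq : ∀ v e g f h, e ≠ g → e ∈ F → g ∈ F → P.incident e v → P.incident g v → f ∈ F → h ∈ F →
    P.incident f (P.tgt e v) → P.incident h (P.tgt g v) → f ≠ e → h ≠ g →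
    P.tgt f (P.tgt e v) = P.tgt h (P.tgt g v)
  noloop : ∀ v e, P.incident e v → P.endCount v e = 1

lemma exists_fac (hd : ∀ v, P.degree v = 3) {F : Set P.E} (h : P.IsCQFactor F) :
    ∃ M, P.Fac F M := by
  have hloc := locAt_of_factor h
  have key : ∀ v, ∃ m, ∃ p q, P.endCount v m = 1 ∧ m ∉ F ∧ p ≠ q ∧ m ≠ p ∧ m ≠ q ∧ p ∈ F ∧ q ∈ F ∧
      P.endCount v p = 1 ∧ P.endCount v q = 1 ∧
      (∀ e, P.incident e v → e = p ∨ e = q ∨ e = m) ∧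
      ∃ y, (∀ f ∈ F, P.incident f (P.tgt p v) → f ≠ p → P.tgt f (P.tgt p v) = y) ∧
      (∀ f ∈ F, P.incident f (P.tgt q v) → f ≠ q → P.tgt f (P.tgt q v) = y) := by
    intro v
    obtain ⟨p, q, hpq, hp, hq, cp, cq, hF, hy⟩ := hloc v
    obtain ⟨m, h1, h2, h3, h4⟩ := third_edge (hd v) hpq cp cq
    refine ⟨m, p, q, h3, fun hm => ?_, hpq, h1, h2, hp, hq, cp, cq, h4, hy⟩
    have := hF m hm ((ec_pos _ _).1 (by omega))
    tauto
  choose M p q cM hM hpq hMp hMq hp hq cp cq hall y hy1 hy2 using key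
  have ip : ∀ v, P.incident (p v) v := fun v => (ec_pos _ _).1 (by rw [cp]; simp)
  have iq : ∀ v, P.incident (q v) v := fun v => (ec_pos _ _).1 (by rw [cq]; simp)
  refine ⟨M, ⟨fun v => (ec_pos _ _).1 (by rw [cM]; simp), hM, ?_, ?_, ?_, ?_, ?_⟩⟩
  · intro v e he hne
    rcases hall v e he with h | h | h
    · rw [h]; exact hp v
    · rw [h]; exact hq v
    · exact absurd h hne
  · intro v e
    by_cases h : p v = e
    · exact ⟨q v, iq v, (hMq v).symm, fun h' => hpq v (h.trans h'.symm)⟩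
    · exact ⟨p v, ip v, (hMp v).symm, h⟩
  · intro v a b c d ha hb hc hd hab hac hbc
    have h1 := hall v a ha
    have h2 := hall v b hb
    have h3 := hall v c hc
    have h4 := hall v d hd
    grind
  · intro v e g f h heg he hg ie ig hf hh i_f ih hfe hhg
    have h1 := hall v e ie
    have h2 := hall v g ig
    have h3 : e ≠ M v := fun h => hM v (h ▸ he)
    have h4 : g ≠ M v := fun h => hM v (h ▸ hg)
    have a1 := hy1 v
    have a2 := hy2 v
    rcases h1 with h1 | h1 | h1
    · have h2 : g = q v := by grind
      subst h1; subst h2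
      rw [a1 f hf i_f hfe, a2 h hh ih hhg]
    · have h2 : g = p v := by grind
      subst h1; subst h2
      rw [a2 f hf i_f hfe, a1 h hh ih hhg]
    · exact absurd h1 h3
  · intro v e he
    rcases hall v e he with h | h | h <;> rw [h]
    · exact cp v
    · exact cq v
    · exact cM v

lemma semi_of_tgt_eq {e : P.E} {v : P.V} (hi : P.incident e v) (hc : P.endCount v e = 1)
    (h : P.tgt e v = v) : P.ends e = .semi v := by
  rcases inc_cases hi with h' | ⟨h', h2⟩
  · rw [h] at h'
    have h'' : P.ends e = .edge v v := by rcases h' with h' | h' <;> exact h'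
    simp [endCount, h''] at hc
  · exact (h' : P.ends e = .semi v)

/-- An endpoint of an edge. -/
def ep (P : Pregraph) (e : P.E) : P.V :=
  match P.ends e with
  | .edge a _ => a
  | .semi a => a

lemma inc_ep (e : P.E) : P.incident e (P.ep e) := by
  unfold incident ep; split <;> simp_all

/-- Gluing local edge maps to an isomorphism. -/
lemma factorIso_of_local {F1 F2 : Set P.E}
    (hnl : ∀ v e, P.incident e v → P.endCount v e = 1)
    (τ : P.V → P.V) (hτ : Function.Involutive τ) (φ : P.V → P.E → P.E)
    (hi : ∀ v e, P.incident e v → P.incident (φ v e) (τ v))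
    (ht : ∀ v e, P.incident e v → P.tgt (φ v e) (τ v) = τ (P.tgt e v))
    (hφ : ∀ v e, P.incident e v → φ (P.tgt e v) e = φ v e)
    (hinv : ∀ v e, P.incident e v → φ (τ v) (φ v e) = e)
    (hF : ∀ v e, P.incident e v → (e ∈ F1 ↔ φ v e ∈ F2)) : FactorIso P F1 F2 := by
  have hφ' : ∀ v e, P.incident e v → φ (P.ep e) e = φ v e := by
    intro v e he
    rcases eq_of_inc he (inc_ep e) with h | h
    · rw [h]
    · rw [h, hφ v e he]
  have hε : Function.Involutive (fun e => φ (P.ep e) e) := by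
    intro e
    have he := inc_ep e
    simp only
    rw [hφ' _ _ (hi _ _ he), hinv _ _ he]
  refine ⟨⟨hτ.toPerm, hε.toPerm, ?_⟩, ?_⟩
  · intro e
    simp only [Function.Involutive.coe_toPerm]
    have he := inc_ep e
    have h1 := hi _ _ he
    have h2 := ht _ _ he
    rcases inc_cases he with h | ⟨h, h'⟩
    · by_cases heq : P.tgt e (P.ep e) = P.ep e
      · rw [heq] at h2
        rw [semi_of_tgt_eq he (hnl _ _ he) heq, semi_of_tgt_eq h1 (hnl _ _ h1) h2]
        simp [endsRel]
      · rcases inc_cases h1 with k | ⟨k, k'⟩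
        · rw [h2] at k
          rcases h with h | h <;> rw [h] <;> simp only [endsRel] <;>
            rcases k with k | k <;> simp [k]
        · rw [k'] at h2
          exact absurd (hτ.injective h2).symm heq
    · rw [h'] at h2
      rw [h, semi_of_tgt_eq h1 (hnl _ _ h1) h2]
      simp [endsRel]
  · intro e
    exact hF _ _ (inc_ep e)

namespace Fac
variable {F F1 F2 F3 : Set P.E} {M M1 M2 M3 : P.V → P.E}

lemma mem_iff (h : P.Fac F M) {v : P.V} {e : P.E} (he : P.incident e v) : e ∈ F ↔ e ≠ M v :=
  ⟨fun h' h'' => h.notin v (h'' ▸ h'), h.mem v e he⟩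

lemma eq_of_inc (h : P.Fac F M) {v w : P.V} (hw : P.incident (M v) w) : M w = M v := by
  by_contra hne
  exact h.notin v (h.mem w _ hw (Ne.symm hne))

lemma M_tgt (h : P.Fac F M) (v : P.V) : M (P.tgt (M v) v) = M v :=
  h.eq_of_inc (inc_tgt (h.inc v))

/-- Agreement (up to parallel edges) propagates along edges. -/
lemma step (h1 : P.Fac F1 M1) (h2 : P.Fac F2 M2) {v : P.V} {e : P.E} (he : P.incident e v)
    (hv : P.tgt (M1 v) v = P.tgt (M2 v) v) :
    P.tgt (M1 (P.tgt e v)) (P.tgt e v) = P.tgt (M2 (P.tgt e v)) (P.tgt e v) := by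
  have three := h1.three
  have it := @inc_tgt P
  by_cases e1 : e = M1 v
  · have hM1 := h1.M_tgt v
    have hM2 := h2.M_tgt v
    rw [e1, hM1, tgt_tgt (h1.inc v), hv, hM2, tgt_tgt (h2.inc v)]
  by_cases e2 : e = M2 v
  · have hM1 := h1.M_tgt v
    have hM2 := h2.M_tgt v
    rw [e2, hM2, tgt_tgt (h2.inc v), ← hv, hM1, tgt_tgt (h1.inc v)]
  have iw := inc_tgt he
  set w := P.tgt e v with hw
  have hew1 : e ∈ F1 := h1.mem v e he e1
  have hew2 : e ∈ F2 := h2.mem v e he e2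
  have n1 : e ≠ M1 w := (h1.mem_iff iw).1 hew1
  have n2 : e ≠ M2 w := (h2.mem_iff iw).1 hew2
  by_cases hMw : M1 w = M2 w
  · rw [hMw]
  -- the other `F1`-edge at `w` is `M2 w` and conversely
  have m21 : M2 w ∈ F1 := (h1.mem_iff (h2.inc w)).2 (Ne.symm hMw)
  have m12 : M1 w ∈ F2 := (h2.mem_iff (h1.inc w)).2 hMw
  by_cases hM : M1 v = M2 v
  · obtain ⟨g, ig, g1, g2⟩ := h1.other v e
    have gF1 := h1.mem v g ig g1
    have gF2 := h2.mem v g ig (hM ▸ g1)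
    obtain ⟨p, ip, p1, p2⟩ := h1.other (P.tgt g v) g
    obtain ⟨q, iq, q1, q2⟩ := h2.other (P.tgt g v) g
    have pF := h1.mem _ p ip p1
    have qF := h2.mem _ q iq q1
    have s1 := h1.sq v e g (M2 w) p g2.symm hew1 gF1 he ig m21 pF (h2.inc w) ip n2.symm p2
    have s2 := h2.sq v e g (M1 w) q g2.symm hew2 gF2 he ig m12 qF (h1.inc w) iq n1.symm q2
    rw [← hw] at s1 s2
    have igx := inc_tgt ig
    by_cases hpq : p = q
    · rw [s1, s2, hpq]
    · -- then `M1 x = q`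
      have gx1 : g ≠ M1 (P.tgt g v) := (h1.mem_iff igx).1 gF1
      have hq : M1 (P.tgt g v) = q := by
        rcases three _ g p q (M1 (P.tgt g v)) igx ip iq (h1.inc _) p2.symm q2.symm hpq with h | h | h
        · exact absurd h.symm gx1
        · exact absurd h.symm p1
        · exact h
      rw [← hq] at s2
      have hM1q := h1.M_tgt (P.tgt g v)
      have hM1w := h1.M_tgt w
      have hxw : P.tgt g v = w := by
        rw [← tgt_tgt (h1.inc (P.tgt g v)), ← s2, ← hM1q, ← s2, hM1w, tgt_tgt (h1.inc w)]
      -- so `e, g` are parallel, and `M1 w = M2 w`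
      rw [hxw] at igx
      have k1 : g ≠ M1 w := (h1.mem_iff igx).1 gF1
      have k2 : g ≠ M2 w := (h2.mem_iff igx).1 gF2
      exfalso
      rcases three w e g (M1 w) (M2 w) iw igx (h1.inc w) (h2.inc w) g2.symm n1 k1 with h | h | h
      · exact n2 h.symm
      · exact k2 h.symm
      · exact hMw h.symm
  · have a1 : M2 v ∈ F1 := (h1.mem_iff (h2.inc v)).2 (Ne.symm hM)
    have a2 : M1 v ∈ F2 := (h2.mem_iff (h1.inc v)).2 hM
    have hM1 := h1.M_tgt v
    have hM2 := h2.M_tgt v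
    have iu1 := inc_tgt (h1.inc v)
    have iu2 := inc_tgt (h2.inc v)
    obtain ⟨p, ip, p1, p2⟩ := h1.other (P.tgt (M2 v) v) (M2 v)
    rw [← hv, hM1] at p1
    have pF1 : p ∈ F1 := h1.mem _ p ip (by rw [← hv, hM1]; exact p1)
    have pF2 : p ∈ F2 := h2.mem _ p ip (by rw [hM2]; exact p2)
    have s1 := h1.sq v e (M2 v) (M2 w) p e2 hew1 a1 he (h2.inc v) m21 pF1 (h2.inc w) ip n2.symm p2
    have s2 := h2.sq v e (M1 v) (M1 w) p e1 hew2 a2 he (h1.inc v) m12 pF2 (h1.inc w)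
      (by rw [hv]; exact ip) n1.symm p1
    rw [← hw] at s1 s2
    rw [s1, s2, hv]

lemma all_same (hc : P.Connected) (h1 : P.Fac F1 M1) (h2 : P.Fac F2 M2) {v : P.V}
    (hv : P.tgt (M1 v) v = P.tgt (M2 v) v) (w : P.V) : P.tgt (M1 w) w = P.tgt (M2 w) w := by
  induction hc v w with
  | refl => exact hv
  | tail _ h ih =>
    obtain ⟨e, he⟩ := h
    have := h1.step h2 ((inc_joins he _).2 (Or.inl rfl)) ih
    rwa [tgt_joins he] at this

lemma iso_of_same (h1 : P.Fac F1 M1) (h2 : P.Fac F2 M2)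
    (hs : ∀ v, P.tgt (M1 v) v = P.tgt (M2 v) v) : FactorIso P F1 F2 := by
  have key : ∀ v e, P.incident e v → P.incident (Equiv.swap (M1 v) (M2 v) e) v ∧
      P.tgt (Equiv.swap (M1 v) (M2 v) e) v = P.tgt e v := by
    intro v e he
    have := h1.inc v
    have := h2.inc v
    have := hs v
    rw [Equiv.swap_apply_def]
    grind
  refine factorIso_of_local h1.noloop id (fun _ => rfl) (fun v e => Equiv.swap (M1 v) (M2 v) e)
    (fun v e he => (key v e he).1) (fun v e he => (key v e he).2) ?_ ?_ ?_
  · intro v e he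
    have iw := inc_tgt he
    have t1 := h1.M_tgt v
    have t2 := h2.M_tgt v
    have b1 := @h1.eq_of_inc _ _ _ (P.tgt e v) v
    have b2 := @h2.eq_of_inc _ _ _ (P.tgt e v) v
    have := hs v
    simp only [Equiv.swap_apply_def]
    grind
  · intro v e he
    simp
  · intro v e he
    rw [h1.mem_iff he, h2.mem_iff (key v e he).1]
    rw [not_iff_not]
    constructor
    · intro h; simp [h]
    · intro h
      exact (Equiv.swap (M1 v) (M2 v)).injective (h.trans (Equiv.swap_apply_left _ _).symm)

/-- The action of `(ℤ/2)³`. -/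
def act (m1 m2 m3 : P.V → P.V) (a b c : Bool) (v : P.V) : P.V :=
  (if a then m1 else id) ((if b then m2 else id) ((if c then m3 else id) v))

lemma comm (h1 : P.Fac F1 M1) (h2 : P.Fac F2 M2) (h3 : P.Fac F3 M3)
    (n12 : ∀ v, M1 v ≠ M2 v) (n13 : ∀ v, M1 v ≠ M3 v) (n23 : ∀ v, M2 v ≠ M3 v) (v : P.V) :
    P.tgt (M2 (P.tgt (M1 v) v)) (P.tgt (M1 v) v) =
      P.tgt (M1 (P.tgt (M2 v) v)) (P.tgt (M2 v) v) := by
  have e1 := (h3.mem_iff (h1.inc v)).2 (n13 v)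
  have e2 := (h3.mem_iff (h2.inc v)).2 (n23 v)
  refine h3.sq v (M1 v) (M2 v) _ _ (n12 v) e1 e2 (h1.inc v) (h2.inc v)
    ((h3.mem_iff (h2.inc _)).2 (n23 _)) ((h3.mem_iff (h1.inc _)).2 (n13 _))
    (h2.inc _) (h1.inc _) ?_ ?_
  · intro h
    exact n12 _ ((h1.M_tgt v).trans h.symm)
  · intro h
    exact n12 _ (h.trans (h2.M_tgt v).symm)

lemma iso_of_three (hc : P.Connected) (h1 : P.Fac F1 M1) (h2 : P.Fac F2 M2) (h3 : P.Fac F3 M3)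
    (n12 : ∀ v, P.tgt (M1 v) v ≠ P.tgt (M2 v) v) (n13 : ∀ v, P.tgt (M1 v) v ≠ P.tgt (M3 v) v)
    (n23 : ∀ v, P.tgt (M2 v) v ≠ P.tgt (M3 v) v) (v0 : P.V)
    (f1 : P.tgt (M1 v0) v0 ≠ v0) (f2 : P.tgt (M2 v0) v0 ≠ v0) : FactorIso P F1 F2 := by
  have k12 : ∀ v, M1 v ≠ M2 v := fun v h => n12 v (by rw [h])
  have k13 : ∀ v, M1 v ≠ M3 v := fun v h => n13 v (by rw [h])
  have k23 : ∀ v, M2 v ≠ M3 v := fun v h => n23 v (by rw [h])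
  obtain ⟨m1, hm1⟩ : ∃ m : P.V → P.V, ∀ v, m v = P.tgt (M1 v) v := ⟨_, fun _ => rfl⟩
  obtain ⟨m2, hm2⟩ : ∃ m : P.V → P.V, ∀ v, m v = P.tgt (M2 v) v := ⟨_, fun _ => rfl⟩
  obtain ⟨m3, hm3⟩ : ∃ m : P.V → P.V, ∀ v, m v = P.tgt (M3 v) v := ⟨_, fun _ => rfl⟩
  have M1m : ∀ v, M1 (m1 v) = M1 v := fun v => by rw [hm1]; exact h1.M_tgt v
  have M2m : ∀ v, M2 (m2 v) = M2 v := fun v => by rw [hm2]; exact h2.M_tgt v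
  have M3m : ∀ v, M3 (m3 v) = M3 v := fun v => by rw [hm3]; exact h3.M_tgt v
  have i1 : ∀ v, m1 (m1 v) = v := fun v => by
    rw [hm1 (m1 v), M1m, hm1]; exact tgt_tgt (h1.inc v)
  have i2 : ∀ v, m2 (m2 v) = v := fun v => by
    rw [hm2 (m2 v), M2m, hm2]; exact tgt_tgt (h2.inc v)
  have i3 : ∀ v, m3 (m3 v) = v := fun v => by
    rw [hm3 (m3 v), M3m, hm3]; exact tgt_tgt (h3.inc v)
  have c21 : ∀ v, m2 (m1 v) = m1 (m2 v) := fun v => by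
    rw [hm2, hm1 v, hm1, hm2]; exact comm h1 h2 h3 k12 k13 k23 v
  have c31 : ∀ v, m3 (m1 v) = m1 (m3 v) := fun v => by
    rw [hm3, hm1 v, hm1, hm3]
    exact comm h1 h3 h2 k13 k12 (fun v => (k23 v).symm) v
  have c32 : ∀ v, m3 (m2 v) = m2 (m3 v) := fun v => by
    rw [hm3, hm2 v, hm2, hm3]
    exact comm h2 h3 h1 k23 (fun v => (k12 v).symm) (fun v => (k13 v).symm) v
  have all : ∀ v e, P.incident e v → e = M1 v ∨ e = M2 v ∨ e = M3 v := fun v e he =>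
    h1.three v _ _ _ e (h1.inc v) (h2.inc v) (h3.inc v) he (k12 v) (k13 v) (k23 v)
  -- transitivity
  have tr : ∀ w, ∃ a b c, act m1 m2 m3 a b c v0 = w := by
    intro w
    induction hc v0 w with
    | refl => exact ⟨false, false, false, rfl⟩
    | tail _ h ih =>
      rename_i u w _
      obtain ⟨e, he⟩ := h
      obtain ⟨a, b, c, ih⟩ := ih
      have ht := tgt_joins he
      rcases all u e ((inc_joins he _).2 (Or.inl rfl)) with h | h | h
      · refine ⟨!a, b, c, ?_⟩
        rw [← ht, h, ← hm1, ← ih]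
        cases a <;> simp [act, i1]
      · refine ⟨a, !b, c, ?_⟩
        rw [← ht, h, ← hm2, ← ih]
        cases a <;> cases b <;> simp [act, i2, c21]
      · refine ⟨a, b, !c, ?_⟩
        rw [← ht, h, ← hm3, ← ih]
        cases a <;> cases b <;> cases c <;> simp [act, i3, c31, c32]
  have stab : ∀ a b c, act m1 m2 m3 a b c v0 = v0 → act m1 m2 m3 b a c v0 = v0 := by
    intro a b c h
    have q12 := n12 v0
    have q13 := n13 v0
    have q23 := n23 v0
    rw [← hm1, ← hm2] at q12
    rw [← hm1, ← hm3] at q13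
    rw [← hm2, ← hm3] at q23
    rw [← hm1] at f1
    rw [← hm2] at f2
    have r1 := i1 (m3 v0)
    have r2 := i2 (m3 v0)
    have r3 := c21 (m3 v0)
    have r4 := c21 v0
    cases a <;> cases b <;> cases c <;> simp [act] at h ⊢ <;> grind
  have addl : ∀ a b c a' b' c' v, act m1 m2 m3 a b c (act m1 m2 m3 a' b' c' v) =
      act m1 m2 m3 (xor a a') (xor b b') (xor c c') v := by
    intro a b c a' b' c' v
    cases a <;> cases b <;> cases c <;> cases a' <;> cases b' <;> cases c' <;>
      simp [act, i1, i2, i3, c21, c31, c32]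
  have wd : ∀ a b c a' b' c', act m1 m2 m3 a b c v0 = act m1 m2 m3 a' b' c' v0 →
      act m1 m2 m3 b a c v0 = act m1 m2 m3 b' a' c' v0 := by
    intro a b c a' b' c' h
    have h' := congrArg (act m1 m2 m3 a' b' c') h
    rw [addl, addl] at h'
    simp only [Bool.xor_self] at h'
    have h'' := stab _ _ _ (h'.trans rfl)
    rw [← addl] at h''
    have h3 := congrArg (act m1 m2 m3 b' a' c') h''
    rw [addl] at h3
    simp only [Bool.xor_self] at h3
    exact h3
  choose α β γ hα using tr
  obtain ⟨τ, hτ⟩ : ∃ τ : P.V → P.V, ∀ a b c, τ (act m1 m2 m3 a b c v0) = act m1 m2 m3 b a c v0 :=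
    ⟨fun w => act m1 m2 m3 (β w) (α w) (γ w) v0, fun a b c => wd _ _ _ _ _ _ (hα _)⟩
  have τ1 : ∀ w, τ (m1 w) = m2 (τ w) := by
    intro w
    have e1 : m1 w = act m1 m2 m3 true false false w := rfl
    have e2 : ∀ w, m2 w = act m1 m2 m3 false true false w := fun _ => rfl
    rw [e1, e2, ← hα w, addl, hτ, hτ, addl]
  have τ2 : ∀ w, τ (m2 w) = m1 (τ w) := by
    intro w
    have e1 : ∀ w, m1 w = act m1 m2 m3 true false false w := fun _ => rfl
    have e2 : m2 w = act m1 m2 m3 false true false w := rfl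
    rw [e1, e2, ← hα w, addl, hτ, hτ, addl]
  have τ3 : ∀ w, τ (m3 w) = m3 (τ w) := by
    intro w
    have e1 : ∀ w, m3 w = act m1 m2 m3 false false true w := fun _ => rfl
    rw [e1, e1, ← hα w, addl, hτ, hτ, addl]
  have ττ : Function.Involutive τ := by
    intro w
    rw [← hα w, hτ, hτ]
  obtain ⟨φ, φ1, φ2, φ3⟩ : ∃ φ : P.V → P.E → P.E, (∀ v, φ v (M1 v) = M2 (τ v)) ∧
      (∀ v, φ v (M2 v) = M1 (τ v)) ∧ (∀ v, φ v (M3 v) = M3 (τ v)) := by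
    refine ⟨fun v e => if e = M1 v then M2 (τ v) else if e = M2 v then M1 (τ v) else M3 (τ v),
      fun v => by simp, fun v => ?_, fun v => ?_⟩
    · simp [(k12 v).symm]
    · simp [(k13 v).symm, (k23 v).symm]
  refine factorIso_of_local h1.noloop τ ττ φ ?_ ?_ ?_ ?_ ?_
  · intro v e he
    rcases all v e he with rfl | rfl | rfl
    · rw [φ1]; exact h2.inc _
    · rw [φ2]; exact h1.inc _
    · rw [φ3]; exact h3.inc _
  · intro v e he
    rcases all v e he with rfl | rfl | rfl
    · rw [φ1, ← hm1, ← hm2, τ1]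
    · rw [φ2, ← hm1, ← hm2, τ2]
    · rw [φ3, ← hm3, ← hm3, τ3]
  · intro v e he
    rcases all v e he with rfl | rfl | rfl
    · rw [φ1, ← hm1]; have := φ1 (m1 v); rwa [M1m, τ1, M2m] at this
    · rw [φ2, ← hm2]; have := φ2 (m2 v); rwa [M2m, τ2, M1m] at this
    · rw [φ3, ← hm3]; have := φ3 (m3 v); rwa [M3m, τ3, M3m] at this
  · intro v e he
    rcases all v e he with rfl | rfl | rfl
    · rw [φ1, φ2, ττ]
    · rw [φ2, φ1, ττ]
    · rw [φ3, φ3, ττ]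
  · intro v e he
    rw [h1.mem_iff he]
    rcases all v e he with rfl | rfl | rfl
    · rw [φ1, h2.mem_iff (h2.inc _)]; simp
    · rw [φ2, h2.mem_iff (h1.inc _)]; simp [k12, (k12 v).symm]
    · rw [φ3, h2.mem_iff (h3.inc _)]
      simp [(k13 v).symm, (k23 (τ v)).symm]

end Fac

end Pregraph

/-- Every cubic pregraph that has a `C₄`-quotient 2-factor has at
most two pairwise non-isomorphic `C₄`-quotient 2-factors. -/
theorem at_most_two_nonisomorphic_CQfactors (P : Pregraph) (hP : P.Cubic)
    (F1 F2 F3 : Set P.E)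
    (h1 : P.IsCQFactor F1) (h2 : P.IsCQFactor F2) (h3 : P.IsCQFactor F3)
    (h12 : ¬ Pregraph.FactorIso P F1 F2) (h13 : ¬ Pregraph.FactorIso P F1 F3)
    (h23 : ¬ Pregraph.FactorIso P F2 F3) :
    False := by
  obtain ⟨hc, hd⟩ := hP
  obtain ⟨M1, H1⟩ := Pregraph.exists_fac hd h1
  obtain ⟨M2, H2⟩ := Pregraph.exists_fac hd h2
  obtain ⟨M3, H3⟩ := Pregraph.exists_fac hd h3
  have n12 : ∀ v, P.tgt (M1 v) v ≠ P.tgt (M2 v) v := fun v h =>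
    h12 (H1.iso_of_same H2 (H1.all_same hc H2 h))
  have n13 : ∀ v, P.tgt (M1 v) v ≠ P.tgt (M3 v) v := fun v h =>
    h13 (H1.iso_of_same H3 (H1.all_same hc H3 h))
  have n23 : ∀ v, P.tgt (M2 v) v ≠ P.tgt (M3 v) v := fun v h =>
    h23 (H2.iso_of_same H3 (H2.all_same hc H3 h))
  rcases isEmpty_or_nonempty P.V with hV | ⟨⟨v0⟩⟩
  · exact h12 (H1.iso_of_same H2 (fun v => hV.elim v))
  by_cases f1 : P.tgt (M1 v0) v0 = v0
  · exact h23 (H2.iso_of_three hc H3 H1 n23 (fun v => (n12 v).symm) (fun v => (n13 v).symm) v0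
      (fun h => n12 v0 (f1.trans h.symm)) (fun h => n13 v0 (f1.trans h.symm)))
  by_cases f2 : P.tgt (M2 v0) v0 = v0
  · exact h13 (H1.iso_of_three hc H3 H2 n13 n12 (fun v => (n23 v).symm) v0
      f1 (fun h => n23 v0 (f2.trans h.symm)))
  · exact h12 (H1.iso_of_three hc H2 H3 n12 n13 n23 v0 f1 f2)
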